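/- arXiv:2504.07663 — 4 statements merged into one kernel-verified Lean document; each statement's English description precedes it below -/
import Mathlib

section
/- The function h is convex as a sequence: for all natural numbers k_A < k_B < k_C with k_C ≤ n, one has (k_C − k_A) · h(k_B) ≤ (k_C − k_B) · h(k_A) + (k_B − k_A) · h(k_C). -/
open Finset

noncomputable section

/-- Cost of the assignment `π` (customer `j` is assigned to supplier `π j`)
when the suppliers in `A` are upgraded. -/
def assignCost {n : ℕ} (b c d : Fin n → ℝ) (A : Finset (Fin n))
    (π : Equiv.Perm (Fin n)) : ℝ :=
  ∑ j, (if π j ∈ A then b (π j) else c (π j)) * d j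

/-- `cost A` : minimum assignment cost when upgrading the suppliers in `A`. -/
def cost {n : ℕ} (b c d : Fin n → ℝ) (A : Finset (Fin n)) : ℝ :=
  Finset.univ.inf' Finset.univ_nonempty (assignCost b c d A)

/-- The LP feasible region `P(k)`. -/
def Pk (n k : ℕ) : Set ((Fin n → Fin n → ℝ) × (Fin n → Fin n → ℝ)) :=
  {p | (∀ i j, 0 ≤ p.1 i j) ∧ (∀ i j, 0 ≤ p.2 i j) ∧
    (∀ j, ∑ i, (p.1 i j + p.2 i j) = 1) ∧
    (∀ i, ∑ j, (p.1 i j + p.2 i j) = 1) ∧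
    (∑ i, ∑ j, p.1 i j) ≤ (k : ℝ)}

/-- The LP objective. -/
def obj {n : ℕ} (b c d : Fin n → ℝ)
    (p : (Fin n → Fin n → ℝ) × (Fin n → Fin n → ℝ)) : ℝ :=
  ∑ i, ∑ j, (b i * p.1 i j + c i * p.2 i j) * d j

/-- A point is integral if all of its entries lie in `{0, 1}`. -/
def Integral {n : ℕ} (p : (Fin n → Fin n → ℝ) × (Fin n → Fin n → ℝ)) : Prop :=
  (∀ i j, p.1 i j = 0 ∨ p.1 i j = 1) ∧ (∀ i j, p.2 i j = 0 ∨ p.2 i j = 1)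

/-- `f_{A,B}(k)`. -/
def fpair {n : ℕ} (b c d : Fin n → ℝ) (k : ℕ) (A B : Finset (Fin n)) : ℝ :=
  (((B.card : ℝ) - k) * cost b c d A + ((k : ℝ) - A.card) * cost b c d B) /
    ((B.card : ℝ) - A.card)

/-- `(A, B)` is an optimal pair. -/
def OptimalPair {n : ℕ} (b c d : Fin n → ℝ) (k : ℕ) (A B : Finset (Fin n)) : Prop :=
  A.card < k ∧ k < B.card ∧ IsLeast (obj b c d '' Pk n k) (fpair b c d k A B)

/-- `X` is simple: some optimal assignment for upgrading `X` assigns every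
upgraded supplier to a customer with positive demand. -/
def SimpleSet {n : ℕ} (b c d : Fin n → ℝ) (X : Finset (Fin n)) : Prop :=
  ∃ π : Equiv.Perm (Fin n), assignCost b c d X π = cost b c d X ∧
    ∀ j, π j ∈ X → 0 < d j

/-- `(A, B)` is clean. -/
def Clean {n : ℕ} (b c : Fin n → ℝ) (A B : Finset (Fin n)) : Prop :=
  ∀ i ∈ symmDiff A B, ∀ i' ∈ symmDiff A B, ¬ (b i < b i' ∧ c i' < c i)

/-- `(A', B')` is a redistribution of `(A, B)` : the elements of `A ∆ B` are
enumerated `e 0, e 1, …` with `b` and `c` both nondecreasing along the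
enumeration, the elements with odd (0-based) index go to `A'` and those with
even (0-based) index go to `B'` (on top of `A ∩ B`). -/
def Redistribution {n : ℕ} (b c : Fin n → ℝ) (A B A' B' : Finset (Fin n)) : Prop :=
  ∃ (ℓ : ℕ) (e : Fin ℓ → Fin n), Function.Injective e ∧
    Finset.image e Finset.univ = symmDiff A B ∧
    Monotone (b ∘ e) ∧ Monotone (c ∘ e) ∧
    A' = (A ∩ B) ∪
      Finset.image e ((Finset.univ : Finset (Fin ℓ)).filter (fun s => (s : ℕ) % 2 = 1)) ∧
    B' = (A ∩ B) ∪
      Finset.image e ((Finset.univ : Finset (Fin ℓ)).filter (fun s => (s : ℕ) % 2 = 0))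

/-- The 0/1 point of the LP corresponding to assignment `π` with upgraded set `A`. -/
def chi {n : ℕ} (π : Equiv.Perm (Fin n)) (A : Finset (Fin n)) :
    (Fin n → Fin n → ℝ) × (Fin n → Fin n → ℝ) :=
  (fun i j => if π j = i ∧ i ∈ A then 1 else 0,
   fun i j => if π j = i ∧ i ∉ A then 1 else 0)

/-- `hval k'` : minimum of `cost X` over all `X` of cardinality `k'`. -/
def hval {n : ℕ} (b c d : Fin n → ℝ) (k' : ℕ) : ℝ :=
  sInf {v | ∃ X : Finset (Fin n), X.card = k' ∧ cost b c d X = v}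

end

/-- The effective cost of supplier `i` when the suppliers in `A` are upgraded. -/
noncomputable def effCost {n : ℕ} (b c : Fin n → ℝ) (A : Finset (Fin n)) (i : Fin n) : ℝ :=
  if i ∈ A then b i else c i

lemma integrable_indicator_Ico_const (a r : ℝ) :
    MeasureTheory.Integrable ((Set.Ico 0 a).indicator fun _ => r) :=
  (MeasureTheory.integrable_indicator_iff measurableSet_Ico).2
    (MeasureTheory.integrableOn_const (by simp))

/-- Layer-cake formula for a finite weighted sum of nonnegative reals. -/
lemma sum_mul_eq_integral_layers {ι : Type*} [Fintype ι] (α x : ι → ℝ) (hx : ∀ i, 0 ≤ x i) :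
    ∑ i, x i * α i = ∫ t, ∑ i, (Set.Ico 0 (x i)).indicator (fun _ => α i) t := by
  rw [MeasureTheory.integral_finsetSum _ fun i _ => integrable_indicator_Ico_const _ _]
  refine Finset.sum_congr rfl fun i _ => ?_
  rw [MeasureTheory.integral_indicator_const _ measurableSet_Ico]
  simp [hx i]

/-- Layer-cake comparison of two finite weighted sums of nonnegative reals. -/
lemma sum_mul_le_sum_mul_of_layers {ι κ : Type*} [Fintype ι] [Fintype κ]
    (α x : ι → ℝ) (β y : κ → ℝ) (hx : ∀ i, 0 ≤ x i) (hy : ∀ i, 0 ≤ y i)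
    (h : ∀ t : ℝ, (∑ i, if t < x i then α i else 0) ≤ ∑ i, if t < y i then β i else 0) :
    ∑ i, x i * α i ≤ ∑ i, y i * β i := by
  rw [sum_mul_eq_integral_layers α x hx, sum_mul_eq_integral_layers β y hy]
  refine MeasureTheory.integral_mono
    (MeasureTheory.integrable_finsetSum _ fun i _ => integrable_indicator_Ico_const _ _)
    (MeasureTheory.integrable_finsetSum _ fun i _ => integrable_indicator_Ico_const _ _)
    fun t => ?_
  rcases lt_or_ge t 0 with ht | ht
  · simp [not_le.2 ht]
  · simpa [Set.indicator_apply, ht] using h t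

/-- Partial sums of a nonnegative monotone sequence: a balanced split of a smaller total has
smaller value. -/
lemma sum_range_add_sum_range_le {f : ℕ → ℝ} (hf : Monotone f) (hf0 : ∀ j, 0 ≤ f j)
    {p q r s : ℕ} (hpq : p ≤ q + 1) (hqp : q ≤ p + 1) (hsum : p + q ≤ r + s) :
    ∑ j ∈ range p, f j + ∑ j ∈ range q, f j ≤ ∑ j ∈ range r, f j + ∑ j ∈ range s, f j := by
  have hmono : Monotone fun m => ∑ j ∈ range m, f j := fun a b hab =>
    Finset.sum_le_sum_of_subset_of_nonneg (Finset.range_mono hab) fun j _ _ => hf0 j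
  wlog hpq' : p ≤ q generalizing p q
  · have := this hqp hpq (by omega) (by omega)
    linarith
  wlog hrs : r ≤ s generalizing r s
  · have := this (r := s) (s := r) (by omega) (by omega)
    linarith
  induction hk : p - r generalizing r s with
  | zero => exact add_le_add (hmono (by omega)) (hmono (by omega))
  | succ k ih =>
    obtain ⟨s, rfl⟩ : ∃ s', s = s' + 1 := ⟨s - 1, by omega⟩
    have h1 := ih (r := r + 1) (s := s) (by omega) (by omega) (by omega)
    have h2 : f r ≤ f s := hf (by omega)
    rw [Finset.sum_range_succ] at h1 ⊢
    linarith

/-- The values of `d` in increasing order, extended by a constant to a sequence on `ℕ`. -/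
noncomputable def sortedSeq {n : ℕ} (hn : 1 ≤ n) (d : Fin n → ℝ) (j : ℕ) : ℝ :=
  d (Tuple.sort d ⟨min j (n - 1), by omega⟩)

lemma sortedSeq_monotone {n : ℕ} (hn : 1 ≤ n) (d : Fin n → ℝ) : Monotone (sortedSeq hn d) := by
  intro i j hij
  refine Tuple.monotone_sort d ?_
  simp only [Fin.mk_le_mk]
  omega

lemma sortedSeq_fin {n : ℕ} (hn : 1 ≤ n) (d : Fin n → ℝ) (j : Fin n) :
    sortedSeq hn d j = d (Tuple.sort d j) := by
  unfold sortedSeq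
  congr 2
  ext
  simp only
  omega

/-- The sum of a monotone sequence over a finite set is at least that over the initial segment. -/
lemma sum_range_card_le_sum {f : ℕ → ℝ} (hf : Monotone f) (J : Finset ℕ) :
    ∑ j ∈ range J.card, f j ≤ ∑ j ∈ J, f j := by
  induction J using Finset.induction_on_max with
  | empty => simp
  | insert a s hs ih =>
    have ha : a ∉ s := fun h => lt_irrefl _ (hs a h)
    rw [Finset.card_insert_of_notMem ha, Finset.sum_insert ha, Finset.sum_range_succ]
    have : s.card ≤ a := by
      simpa using Finset.card_le_card (fun x hx => Finset.mem_range.2 (hs x hx) : s ⊆ range a)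
    linarith [hf this]

lemma sum_range_card_le_sum_sortedSeq {n : ℕ} (hn : 1 ≤ n) (d : Fin n → ℝ)
    (J : Finset (Fin n)) :
    ∑ j ∈ range J.card, sortedSeq hn d j ≤ ∑ j ∈ J, d j := by
  set σ := Tuple.sort d
  have hinj : Function.Injective fun j : Fin n => (σ.symm j : ℕ) :=
    Fin.val_injective.comp σ.symm.injective
  have h := sum_range_card_le_sum (sortedSeq_monotone hn d) (J.image fun j => (σ.symm j : ℕ))
  rw [Finset.card_image_of_injective _ hinj, Finset.sum_image hinj.injOn] at h
  refine h.trans_eq (Finset.sum_congr rfl fun j _ => ?_)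
  rw [sortedSeq_fin]
  simp [σ]

/-- Some assignment pairs large costs with small demands, so that at every threshold the expensive
suppliers serve the customers of smallest demand. -/
lemma exists_perm_layers_eq {n : ℕ} (hn : 1 ≤ n) (d e : Fin n → ℝ) :
    ∃ π : Equiv.Perm (Fin n), ∀ t : ℝ, (∑ j, if t < e (π j) then d j else 0) =
      ∑ j ∈ range (#{i | t < e i}), sortedSeq hn d j := by
  set τ := Tuple.sort fun i => -e i
  have hτ : Antitone fun j => e (τ j) := fun i j hij =>
    neg_le_neg_iff.1 (Tuple.monotone_sort (fun i => -e i) hij)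
  refine ⟨(Tuple.sort d).symm.trans τ, fun t => ?_⟩
  rw [← Equiv.sum_comp (Tuple.sort d), ← Finset.sum_filter]
  simp only [Equiv.trans_apply, Equiv.symm_apply_apply]
  set J : Finset (Fin n) := {j | t < e (τ j)} with hJ
  have hcard : #{i | t < e i} = J.card := by
    refine (Finset.card_bij (fun j _ => τ j) ?_ ?_ ?_).symm
    · intro j hj; simpa [hJ] using hj
    · intro j _ k _ h; exact τ.injective h
    · intro i hi; exact ⟨τ.symm i, by simpa [hJ] using hi, by simp⟩
  have himage : J.image (fun j : Fin n => (j : ℕ)) = range J.card := by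
    have hlow : ∃ m, J.image (fun j : Fin n => (j : ℕ)) = range m := by
      by_cases h : ∃ j : Fin n, j ∉ J
      · have hex : ∃ m : ℕ, ∃ hm : m < n, (⟨m, hm⟩ : Fin n) ∉ J := by
          obtain ⟨j, hj⟩ := h
          exact ⟨j, j.2, hj⟩
        classical
        obtain ⟨m₀, ⟨hm, hmJ⟩, hmin⟩ : ∃ m₀, (∃ hm : m₀ < n, (⟨m₀, hm⟩ : Fin n) ∉ J) ∧
            ∀ m < m₀, ¬ ∃ hm : m < n, (⟨m, hm⟩ : Fin n) ∉ J :=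
          ⟨Nat.find hex, Nat.find_spec hex, fun _ => Nat.find_min hex⟩
        refine ⟨m₀, ?_⟩
        ext m
        simp only [Finset.mem_image, Finset.mem_range]
        constructor
        · rintro ⟨j, hj, rfl⟩
          by_contra hle
          refine hmJ ?_
          simp only [hJ, Finset.mem_filter, Finset.mem_univ, true_and] at hj ⊢
          exact hj.trans_le (hτ (Fin.mk_le_of_le_val (not_lt.1 hle)))
        · intro hlt
          have := hmin m hlt
          push Not at this
          exact ⟨⟨m, hlt.trans hm⟩, this _, rfl⟩
      · push Not at h
        refine ⟨n, ?_⟩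
        ext m
        simp only [Finset.mem_image, Finset.mem_range]
        exact ⟨fun ⟨j, _, hj⟩ => hj ▸ j.2, fun hm => ⟨⟨m, hm⟩, h _, rfl⟩⟩
    obtain ⟨m, hm⟩ := hlow
    have := congrArg Finset.card hm
    rw [Finset.card_image_of_injective _ Fin.val_injective, Finset.card_range] at this
    rw [hm, this]
  rw [hcard, ← himage, Finset.sum_image Fin.val_injective.injOn]
  exact Finset.sum_congr rfl fun j _ => (sortedSeq_fin hn d j).symm

lemma assignCost_eq {n : ℕ} (b c d : Fin n → ℝ) (A : Finset (Fin n)) (π : Equiv.Perm (Fin n)) :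
    assignCost b c d A π = ∑ j, effCost b c A (π j) * d j := rfl

lemma card_lt_comp_perm {n : ℕ} (e : Fin n → ℝ) (π : Equiv.Perm (Fin n)) (t : ℝ) :
    #{j | t < e (π j)} = #{i | t < e i} := by
  refine Finset.card_bij (fun j _ => π j) ?_ ?_ ?_
  · intro j hj; simpa using hj
  · intro j _ k _ h; exact π.injective h
  · intro i hi; exact ⟨π.symm i, by simpa using hi, by simp⟩

/-- If at every threshold the numbers of expensive suppliers for `A'` and `B'` are balanced and
have no larger total than those for `A` and `B`, then the total cost does not increase. -/
lemma cost_add_cost_le {n : ℕ} (hn : 1 ≤ n) {b c d : Fin n → ℝ}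
    (hb : ∀ i, 0 ≤ b i) (hbc : ∀ i, b i ≤ c i) (hd : ∀ j, 0 ≤ d j) {A B A' B' : Finset (Fin n)}
    (h₁ : ∀ t, #{i | t < effCost b c A' i} ≤ #{i | t < effCost b c B' i} + 1)
    (h₂ : ∀ t, #{i | t < effCost b c B' i} ≤ #{i | t < effCost b c A' i} + 1)
    (h₃ : ∀ t, #{i | t < effCost b c A' i} + #{i | t < effCost b c B' i} ≤
      #{i | t < effCost b c A i} + #{i | t < effCost b c B i}) :
    cost b c d A' + cost b c d B' ≤ cost b c d A + cost b c d B := by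
  have he : ∀ X i, 0 ≤ effCost b c X i := by
    intro X i
    unfold effCost
    split_ifs
    exacts [hb i, (hb i).trans (hbc i)]
  obtain ⟨π, -, hπ⟩ := Finset.exists_mem_eq_inf' Finset.univ_nonempty (assignCost b c d A)
  obtain ⟨ρ, -, hρ⟩ := Finset.exists_mem_eq_inf' Finset.univ_nonempty (assignCost b c d B)
  obtain ⟨π', hπ'⟩ := exists_perm_layers_eq hn d (effCost b c A')
  obtain ⟨ρ', hρ'⟩ := exists_perm_layers_eq hn d (effCost b c B')
  have hA : cost b c d A' ≤ assignCost b c d A' π' := Finset.inf'_le _ (Finset.mem_univ _)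
  have hB : cost b c d B' ≤ assignCost b c d B' ρ' := Finset.inf'_le _ (Finset.mem_univ _)
  have hle : assignCost b c d A' π' + assignCost b c d B' ρ' ≤
      assignCost b c d A π + assignCost b c d B ρ := by
    have := sum_mul_le_sum_mul_of_layers (Sum.elim d d)
      (Sum.elim (fun j => effCost b c A' (π' j)) fun j => effCost b c B' (ρ' j))
      (Sum.elim d d) (Sum.elim (fun j => effCost b c A (π j)) fun j => effCost b c B (ρ j))
      (by rintro (i | i) <;> exact he _ _) (by rintro (i | i) <;> exact he _ _) ?_
    · simpa only [Fintype.sum_sum_type, Sum.elim_inl, Sum.elim_inr, assignCost_eq] using this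
    · intro t
      rw [Fintype.sum_sum_type, Fintype.sum_sum_type]
      change (∑ j, if t < effCost b c A' (π' j) then d j else 0) +
          (∑ j, if t < effCost b c B' (ρ' j) then d j else 0) ≤
        (∑ j, if t < effCost b c A (π j) then d j else 0) +
          ∑ j, if t < effCost b c B (ρ j) then d j else 0
      rw [hπ', hρ']
      refine (sum_range_add_sum_range_le (sortedSeq_monotone hn d) (fun j => hd _)
        (h₁ t) (h₂ t) (h₃ t)).trans (add_le_add ?_ ?_)
      · rw [← Finset.sum_filter, ← card_lt_comp_perm _ π]
        exact sum_range_card_le_sum_sortedSeq hn d _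
      · rw [← Finset.sum_filter, ← card_lt_comp_perm _ ρ]
        exact sum_range_card_le_sum_sortedSeq hn d _
  unfold cost at hA hB ⊢
  linarith

/-- Number of upgraded suppliers in `X` whose cost interval `[b i, c i)` contains `t`. -/
noncomputable def coverage {n : ℕ} (b c : Fin n → ℝ) (X : Finset (Fin n)) (t : ℝ) : ℤ :=
  ∑ i ∈ X, if b i ≤ t ∧ t < c i then 1 else 0

lemma card_lt_effCost {n : ℕ} {b c : Fin n → ℝ} (hbc : ∀ i, b i ≤ c i) (X : Finset (Fin n))
    (t : ℝ) : (#{i | t < effCost b c X i} : ℤ) = #{i | t < c i} - coverage b c X t := by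
  have hcov : coverage b c X t =
      ∑ i, if i ∈ X then (if b i ≤ t ∧ t < c i then (1 : ℤ) else 0) else 0 := by
    simp [coverage]
  rw [hcov, Finset.card_filter, Finset.card_filter]
  push_cast
  rw [← Finset.sum_sub_distrib]
  refine Finset.sum_congr rfl fun i _ => ?_
  have := hbc i
  unfold effCost
  by_cases hi : i ∈ X <;> by_cases h1 : b i ≤ t <;> by_cases h2 : t < c i <;>
    simp [hi, h1, h2, not_lt.2, not_le.1]; grind

/-- A finite set ordered by an injective key carries alternating signs: the signs of every initial
segment sum to `0` or `1`. -/
lemma exists_alternating_signs {ι : Type*} [DecidableEq ι] (f : ι → ℝ) (U : Finset ι)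
    (hf : Set.InjOn f U) :
    ∃ s : ι → ℤ, (∀ i, s i = 1 ∨ s i = -1) ∧ ∀ V ⊆ U,
      (∀ i ∈ U, ∀ j ∈ V, f i < f j → i ∈ V) → ∑ i ∈ V, s i = 0 ∨ ∑ i ∈ V, s i = 1 := by
  induction U using Finset.induction_on_max_value f with
  | empty => exact ⟨fun _ => 1, by simp, fun V hV _ => by simp [Finset.subset_empty.1 hV]⟩
  | insert a U ha hmax ih =>
    obtain ⟨s, hs, hsum⟩ := ih (hf.mono (by simp))
    have hU := hsum U subset_rfl fun i hi _ _ _ => hi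
    refine ⟨Function.update s a (1 - 2 * ∑ i ∈ U, s i), fun i => ?_, fun V hV hlow => ?_⟩
    · by_cases hi : i = a
      · subst hi
        rw [Function.update_self]
        omega
      · rw [Function.update_of_ne hi]
        exact hs i
    · have hupd : ∀ W : Finset ι, a ∉ W →
          ∑ i ∈ W, Function.update s a (1 - 2 * ∑ i ∈ U, s i) i = ∑ i ∈ W, s i := by
        intro W hW
        refine Finset.sum_congr rfl fun i hi => Function.update_of_ne ?_ _ _
        rintro rfl
        exact hW hi
      by_cases haV : a ∈ V
      · have hVeq : V = insert a U := by
          refine hV.antisymm fun i hi => ?_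
          rcases Finset.mem_insert.1 hi with rfl | hiU
          · exact haV
          · refine hlow i hi a haV ((hmax i hiU).lt_of_ne fun h => ha ?_)
            rwa [← hf (by simp [hiU]) (by simp) h]
        rw [hVeq, Finset.sum_insert ha, Function.update_self, hupd U ha]
        omega
      · rw [hupd V haV]
        refine hsum V (fun i hi => ?_) fun i hi => hlow i (Finset.mem_insert_of_mem hi)
        exact Finset.mem_of_mem_insert_of_ne (hV hi) fun h => haV (h ▸ hi)

/-- A set of suppliers whose cost intervals are pairwise not nested splits into two parts which are
balanced in size and at every threshold. -/
lemma exists_balanced_split {n : ℕ} {b c : Fin n → ℝ} (hbc : ∀ i, b i ≤ c i)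
    (U : Finset (Fin n))
    (hU : ∀ i ∈ U, ∀ j ∈ U, i ≠ j → b i ≤ b j → c i < c j) :
    ∃ P Q : Finset (Fin n), Disjoint P Q ∧ P ∪ Q = U ∧ P.card ≤ Q.card ∧ Q.card ≤ P.card + 1 ∧
      ∀ t, |coverage b c P t - coverage b c Q t| ≤ 1 := by
  have hinj : Set.InjOn b U := by
    intro i hi j hj hij
    by_contra hne
    exact lt_asymm (hU i hi j hj hne hij.le) (hU j hj i hi (Ne.symm hne) hij.ge)
  obtain ⟨s, hs, hsum⟩ := exists_alternating_signs b U hinj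
  have hdiff : ∀ g : Fin n → ℤ,
      ∑ i ∈ U with s i = 1, g i - ∑ i ∈ U with s i = -1, g i = ∑ i ∈ U, s i * g i := by
    intro g
    rw [Finset.sum_filter, Finset.sum_filter, ← Finset.sum_sub_distrib]
    refine Finset.sum_congr rfl fun i _ => ?_
    rcases hs i with h | h <;> simp [h]
  have hcard : (#{i ∈ U | s i = 1} : ℤ) - #{i ∈ U | s i = -1} = ∑ i ∈ U, s i := by
    simpa using hdiff fun _ => 1
  have hall := hsum U subset_rfl fun i hi _ _ _ => hi
  refine ⟨{i ∈ U | s i = -1}, {i ∈ U | s i = 1}, ?_, ?_, by omega, by omega, fun t => ?_⟩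
  · rw [Finset.disjoint_filter]
    intro i _ h
    omega
  · rw [← Finset.filter_or, Finset.filter_eq_self]
    intro i _
    exact (hs i).symm
  · have h1 := hsum {i ∈ U | b i ≤ t} (Finset.filter_subset _ _) (by
      intro i hi j hj hij
      simp only [Finset.mem_filter] at hj ⊢
      exact ⟨hi, hij.le.trans hj.2⟩)
    have h2 := hsum {i ∈ U | c i ≤ t} (Finset.filter_subset _ _) (by
      intro i hi j hj hij
      simp only [Finset.mem_filter] at hj ⊢
      refine ⟨hi, (hU i hi j hj.1 ?_ hij.le).le.trans hj.2⟩
      rintro rfl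
      exact lt_irrefl _ hij)
    have h3 : coverage b c {i ∈ U | s i = 1} t - coverage b c {i ∈ U | s i = -1} t =
        ∑ i ∈ U with b i ≤ t, s i - ∑ i ∈ U with c i ≤ t, s i := by
      unfold coverage
      rw [hdiff, Finset.sum_filter, Finset.sum_filter, ← Finset.sum_sub_distrib]
      refine Finset.sum_congr rfl fun i _ => ?_
      have := hbc i
      by_cases hb : b i ≤ t <;> by_cases hc : c i ≤ t
      · simp [hb, hc, not_lt.2 hc]
      · simp [hb, hc, not_le.1 hc]
      · exact absurd (this.trans hc) hb
      · simp [hb, hc]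
    rw [abs_le]
    omega

/-- Repeatedly replacing a nested pair of suppliers, each upgraded once, by two upgrades of the
supplier with the larger cost interval leads to a family without nested pairs. -/
lemma exists_unnested {n : ℕ} (b c : Fin n → ℝ) (I U : Finset (Fin n)) (hIU : Disjoint I U) :
    ∃ I' U' : Finset (Fin n), Disjoint I' U' ∧ 2 * I'.card + U'.card = 2 * I.card + U.card ∧
      (∀ i ∈ U', ∀ j ∈ U', i ≠ j → b i ≤ b j → c i < c j) ∧
      ∀ t, 2 * coverage b c I t + coverage b c U t ≤
        2 * coverage b c I' t + coverage b c U' t := by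
  induction hk : U.card using Nat.strong_induction_on generalizing I U with
  | _ k ih =>
    by_cases h : ∀ i ∈ U, ∀ j ∈ U, i ≠ j → b i ≤ b j → c i < c j
    · exact ⟨I, U, hIU, by omega, h, fun t => le_rfl⟩
    · push Not at h
      obtain ⟨i, hi, j, hj, hij, hb, hc⟩ := h
      have hiI : i ∉ I := Finset.disjoint_right.1 hIU hi
      obtain ⟨W, hW, hiW, hjW⟩ : ∃ W, U = insert i (insert j W) ∧ i ∉ insert j W ∧ j ∉ W := by
        refine ⟨(U.erase i).erase j, ?_, by simp [hij], by simp⟩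
        rw [Finset.insert_erase (by simp [hj, hij.symm]), Finset.insert_erase hi]
      subst hW
      have hc1 : (insert i (insert j W)).card = W.card + 2 := by
        rw [Finset.card_insert_of_notMem hiW, Finset.card_insert_of_notMem hjW]
      have hdisj : Disjoint (insert i I) W := by
        rw [Finset.disjoint_insert_left]
        refine ⟨fun h => hiW (Finset.mem_insert_of_mem h), hIU.mono_right fun x hx => ?_⟩
        simp [hx]
      obtain ⟨I', U', h1, h2, h3, h4⟩ := ih W.card (by omega) (insert i I) W hdisj rfl
      refine ⟨I', U', h1, ?_, h3, fun t => le_trans ?_ (h4 t)⟩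
      · rw [h2, Finset.card_insert_of_notMem hiI]
        omega
      · unfold coverage
        rw [Finset.sum_insert hiW, Finset.sum_insert hjW, Finset.sum_insert hiI]
        have : (if b j ≤ t ∧ t < c j then (1 : ℤ) else 0) ≤
            if b i ≤ t ∧ t < c i then 1 else 0 := by
          split_ifs with p q
          · rfl
          · exact absurd ⟨hb.trans p.1, p.2.trans_le hc⟩ q
          · exact zero_le_one
          · rfl
        linarith

/-- Any two upgrade sets can be replaced by two sets of balanced sizes with the same total size and
no larger total cost. -/
lemma exists_balanced_pair {n : ℕ} (hn : 1 ≤ n) {b c d : Fin n → ℝ}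
    (hb : ∀ i, 0 ≤ b i) (hbc : ∀ i, b i ≤ c i) (hd : ∀ j, 0 ≤ d j) (A B : Finset (Fin n)) :
    ∃ A' B' : Finset (Fin n), A'.card + B'.card = A.card + B.card ∧
      A'.card ≤ B'.card ∧ B'.card ≤ A'.card + 1 ∧
      cost b c d A' + cost b c d B' ≤ cost b c d A + cost b c d B := by
  have hAB : Disjoint (A ∩ B) (symmDiff A B) := by
    rw [Finset.disjoint_left]
    intro i hi hi'
    simp only [Finset.mem_inter, Finset.mem_symmDiff] at hi hi'
    tauto
  have hsum : ∀ g : Fin n → ℤ,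
      2 * ∑ i ∈ A ∩ B, g i + ∑ i ∈ symmDiff A B, g i = ∑ i ∈ A, g i + ∑ i ∈ B, g i := by
    intro g
    have hunion : symmDiff A B ∪ A ∩ B = A ∪ B := symmDiff_sup_inf A B
    rw [← Finset.sum_union_inter, ← hunion, Finset.sum_union hAB.symm]
    ring
  obtain ⟨I, U, hIU, hcard, hchain, hcov⟩ := exists_unnested b c _ _ hAB
  obtain ⟨P, Q, hPQ, rfl, hle, hge, hbal⟩ := exists_balanced_split hbc U hchain
  rw [Finset.disjoint_union_right] at hIU
  have hcard' : 2 * ((A ∩ B).card : ℤ) + (symmDiff A B).card = A.card + B.card := by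
    simpa using hsum fun _ => 1
  have hcovI : ∀ X, Disjoint I X → ∀ t,
      coverage b c (I ∪ X) t = coverage b c I t + coverage b c X t :=
    fun X hX t => Finset.sum_union hX
  rw [Finset.card_union_of_disjoint hPQ] at hcard
  refine ⟨I ∪ P, I ∪ Q, ?_, ?_, ?_, cost_add_cost_le hn hb hbc hd ?_ ?_ ?_⟩
  · rw [Finset.card_union_of_disjoint hIU.1, Finset.card_union_of_disjoint hIU.2]
    omega
  · rw [Finset.card_union_of_disjoint hIU.1, Finset.card_union_of_disjoint hIU.2]
    omega
  · rw [Finset.card_union_of_disjoint hIU.1, Finset.card_union_of_disjoint hIU.2]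
    omega
  all_goals
    intro t
    have e1 := card_lt_effCost hbc (I ∪ P) t
    have e2 := card_lt_effCost hbc (I ∪ Q) t
    have e3 := card_lt_effCost hbc A t
    have e4 := card_lt_effCost hbc B t
    have e5 := abs_le.1 (hbal t)
    have e6 := hcov t
    have e7 : coverage b c (P ∪ Q) t = coverage b c P t + coverage b c Q t :=
      Finset.sum_union hPQ
    have e8 : 2 * coverage b c (A ∩ B) t + coverage b c (symmDiff A B) t =
        coverage b c A t + coverage b c B t := hsum _
    rw [hcovI P hIU.1] at e1
    rw [hcovI Q hIU.2] at e2
    omega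

lemma finite_setOf_cost {n : ℕ} (b c d : Fin n → ℝ) (k : ℕ) :
    {v | ∃ X : Finset (Fin n), X.card = k ∧ cost b c d X = v}.Finite :=
  (Set.finite_range (cost b c d)).subset fun _ ⟨X, _, hX⟩ => ⟨X, hX⟩

lemma hval_le_cost {n : ℕ} (b c d : Fin n → ℝ) (X : Finset (Fin n)) :
    hval b c d X.card ≤ cost b c d X :=
  csInf_le (finite_setOf_cost b c d _).bddBelow ⟨X, rfl, rfl⟩

lemma exists_cost_eq_hval {n : ℕ} (b c d : Fin n → ℝ) {k : ℕ} (hk : k ≤ n) :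
    ∃ X : Finset (Fin n), X.card = k ∧ cost b c d X = hval b c d k := by
  obtain ⟨X, -, hX⟩ := Finset.exists_subset_card_eq (s := (Finset.univ : Finset (Fin n)))
    (n := k) (by simpa using hk)
  exact Set.Nonempty.csInf_mem (s := {v | ∃ X : Finset (Fin n), X.card = k ∧ cost b c d X = v})
    ⟨_, X, hX, rfl⟩ (finite_setOf_cost b c d k)

lemma two_mul_hval_succ_le {n : ℕ} (hn : 1 ≤ n) {b c d : Fin n → ℝ}
    (hb : ∀ i, 0 ≤ b i) (hbc : ∀ i, b i ≤ c i) (hd : ∀ j, 0 ≤ d j) {k : ℕ} (hk : k + 2 ≤ n) :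
    2 * hval b c d (k + 1) ≤ hval b c d k + hval b c d (k + 2) := by
  obtain ⟨A, hA, hA'⟩ := exists_cost_eq_hval b c d (k := k) (by omega)
  obtain ⟨B, hB, hB'⟩ := exists_cost_eq_hval b c d hk
  obtain ⟨X, Y, hsum, hle, hge, hcost⟩ := exists_balanced_pair hn hb hbc hd A B
  have hX := hval_le_cost b c d X
  have hY := hval_le_cost b c d Y
  rw [show X.card = k + 1 by omega] at hX
  rw [show Y.card = k + 1 by omega] at hY
  linarith

/-- A real sequence with nonnegative second differences up to `n` satisfies the three-point
convexity inequality up to `n`. -/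
lemma three_point_of_second_difference {n : ℕ} {H : ℕ → ℝ}
    (hH : ∀ k, k + 2 ≤ n → 2 * H (k + 1) ≤ H k + H (k + 2))
    {p q r : ℕ} (hpq : p < q) (hqr : q < r) (hr : r ≤ n) :
    ((r : ℝ) - p) * H q ≤ ((r : ℝ) - q) * H p + ((q : ℝ) - p) * H r := by
  have hslope : ∀ i j, i ≤ j → j + 1 ≤ n → H (i + 1) - H i ≤ H (j + 1) - H j := by
    intro i j hij
    induction j, hij using Nat.le_induction with
    | base => intro _; rfl
    | succ j _ ih =>
      intro hj
      linarith [ih (by omega), hH j hj]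
  have hright : ∀ m, q + m ≤ n → H q + m * (H (q + 1) - H q) ≤ H (q + m) := by
    intro m
    induction m with
    | zero => simp
    | succ m ih =>
      intro hm
      have := hslope q (q + m) (by omega) hm
      have := ih (by omega)
      push_cast
      rw [← add_assoc]
      linarith
  have hleft : ∀ m i, i + m = q → H q - m * (H (q + 1) - H q) ≤ H i := by
    intro m
    induction m with
    | zero => rintro i rfl; simp
    | succ m ih =>
      intro i hi
      have := hslope i q (by omega) (by omega)
      have := ih (i + 1) (by omega)
      push_cast
      linarith
  have h1 := hright (r - q) (by omega)
  have h2 := hleft (q - p) p (by omega)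
  rw [Nat.add_sub_cancel' hqr.le, Nat.cast_sub hqr.le] at h1
  rw [Nat.cast_sub hpq.le] at h2
  have hqr' : (0 : ℝ) ≤ (r : ℝ) - q := sub_nonneg.2 (by exact_mod_cast hqr.le)
  have hpq' : (0 : ℝ) ≤ (q : ℝ) - p := sub_nonneg.2 (by exact_mod_cast hpq.le)
  have := mul_le_mul_of_nonneg_left h1 hpq'
  have := mul_le_mul_of_nonneg_left h2 hqr'
  linarith

/-- the function `h` is convex as a sequence. -/
theorem stmt8 (n : ℕ) (hn : 1 ≤ n) (b c d : Fin n → ℝ)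
    (hb : ∀ i, 0 ≤ b i) (hbc : ∀ i, b i ≤ c i) (hd : ∀ j, 0 ≤ d j)
    (kA kB kC : ℕ) (hAB : kA < kB) (hBC : kB < kC) (hCn : kC ≤ n) :
    ((kC : ℝ) - kA) * hval b c d kB ≤
      ((kC : ℝ) - kB) * hval b c d kA + ((kB : ℝ) - kA) * hval b c d kC := by
  exact three_point_of_second_difference
    (fun _ hk => two_mul_hval_succ_le hn hb hbc hd hk) hAB hBC hCn
end

section
/- Let n̄ ∈ ℕ, let M_A, M_B : Fin n̄ ≃ Fin n̄ be bijections, and let Ā, B̄ ⊆ Fin n̄. Assume: (a) for every v ∉ Ā △ B̄, the integers M_A v and M_B v differ by at most 1; (b) for every v ∈ Ā \ B̄ one has M_A v ≤ M_B v, and for every v ∈ B̄ \ Ā one has M_B v ≤ M_A v; (c) there do not exist v₁, v₂ ∈ Ā △ B̄ with min(M_A v₁, M_B v₁) < min(M_A v₂, M_B v₂) and max(M_A v₁, M_B v₁) > max(M_A v₂, M_B v₂). Then for every orbit O of the permutation v ↦ M_B⁻¹(M_A v) of Fin n̄, the cardinalities |Ā ∩ O| and |B̄ ∩ O| differ by at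 most 1. -/
open Finset

section CycleLemma

variable {V : Type*}

/-- Signed count, with weights `s`, of the elements of `O` satisfying `P`. -/
def signedCount (O : Finset V) (s : V → ℤ) (P : V → Prop) [DecidablePred P] : ℤ :=
  ∑ w ∈ O, if P w then s w else 0

/-- The elements of `V` are the edges `a v → b v` of a directed graph on `ℤ`: those of sign `1`
point right, those of sign `-1` point left, those of sign `0` have length at most one, and no edge
of nonzero sign lies strictly inside another one. -/
structure SignedEdges (a b s : V → ℤ) : Prop where
  sign : ∀ v, s v = 0 ∨ s v = 1 ∨ s v = -1
  injective_source : Function.Injective a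
  injective_target : Function.Injective b
  short : ∀ v, s v = 0 → |a v - b v| ≤ 1
  right : ∀ v, s v = 1 → a v ≤ b v
  left : ∀ v, s v = -1 → b v ≤ a v
  not_nested : ∀ v w, s v ≠ 0 → s w ≠ 0 → min (a v) (b v) < min (a w) (b w) →
    max (a v) (b v) ≤ max (a w) (b w)

/-- Order the edges of nonzero sign by their midpoint. The level of an edge is the value on its left
side of the function on the complement of the edges that starts at `0` and jumps by the sign across
each edge; an edge of sign `0` is treated as an edge of its own direction. -/
def edgeLevel (a b s : V → ℤ) (O : Finset V) (v : V) : ℤ :=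
  if s v = 1 then signedCount O s (fun w => a w + b w < a v + b v)
  else if s v = -1 then signedCount O s (fun w => a w + b w ≤ a v + b v)
  else if a v < b v then signedCount O s (fun w => min (a w) (b w) < b v)
  else signedCount O s (fun w => max (a w) (b w) < a v)

theorem signedCount_eq_add_of_ne [DecidableEq V] {O : Finset V} {s : V → ℤ} {P : V → Prop} [DecidablePred P]
    {u v : V} (hu : u ∈ O) (hv : v ∈ O) (huv : u ≠ v) :
    signedCount O s P = signedCount ((O.erase u).erase v) s P +
      (if P v then s v else 0) + (if P u then s u else 0) := by
  unfold signedCount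
  rw [← Finset.sum_erase_add O _ hu,
    ← Finset.sum_erase_add (O.erase u) _ (Finset.mem_erase.2 ⟨huv.symm, hv⟩)]

theorem signedCount_congr {O : Finset V} {s : V → ℤ} {P Q : V → Prop} [DecidablePred P]
    [DecidablePred Q] (h : ∀ w ∈ O, s w ≠ 0 → (P w ↔ Q w)) :
    signedCount O s P = signedCount O s Q := by
  refine Finset.sum_congr rfl fun w hw => ?_
  by_cases h0 : s w = 0
  · simp [h0]
  · simp [h w hw h0]

/-- Across every cut of the line, the edges of a set that is invariant under passing to the
preceding edge balance. -/
theorem sum_cut_eq_zero {a b : V → ℤ} {O : Finset V} {σ : Equiv.Perm V}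
    (hσ : ∀ v, b (σ v) = a v) (hO : ∀ v, v ∈ O ↔ σ v ∈ O) (p : ℤ) :
    ∑ w ∈ O, ((if a w < p then (1 : ℤ) else 0) - (if b w < p then 1 else 0)) = 0 := by
  rw [Finset.sum_sub_distrib, sub_eq_zero]
  exact Finset.sum_equiv σ hO fun w _ => by rw [hσ]

namespace SignedEdges

variable {a b s : V → ℤ} (h : SignedEdges a b s)
include h

theorem sign_cases (v : V) :
    (s v = 0 ∧ a v ≤ b v + 1 ∧ b v ≤ a v + 1) ∨ (s v = 1 ∧ a v ≤ b v) ∨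
      (s v = -1 ∧ b v ≤ a v) := by
  rcases h.sign v with e | e | e
  · have := abs_le.1 (h.short v e)
    exact Or.inl ⟨e, by omega, by omega⟩
  · exact Or.inr (Or.inl ⟨e, h.right v e⟩)
  · exact Or.inr (Or.inr ⟨e, h.left v e⟩)

theorem signedCount_sub_signedCount [DecidableEq V] {O : Finset V} {σ : Equiv.Perm V}
    (hσ : ∀ v, b (σ v) = a v) (hO : ∀ v, v ∈ O ↔ σ v ∈ O) {v : V} (hv : v ∈ O)
    (hne : σ v ≠ v) :
    signedCount ((O.erase (σ v)).erase v) s (fun w => min (a w) (b w) < a v) -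
      signedCount ((O.erase (σ v)).erase v) s (fun w => max (a w) (b w) < a v) =
      (if b v < a v then 1 else 0) - (if a (σ v) < a v then 1 else 0) := by
  have key := sum_cut_eq_zero hσ hO (a v)
  rw [← Finset.sum_erase_add O _ ((hO v).1 hv),
    ← Finset.sum_erase_add (O.erase (σ v)) _ (Finset.mem_erase.2 ⟨hne.symm, hv⟩)] at key
  have rest : signedCount ((O.erase (σ v)).erase v) s (fun w => min (a w) (b w) < a v) -
      signedCount ((O.erase (σ v)).erase v) s (fun w => max (a w) (b w) < a v) =
      ∑ w ∈ (O.erase (σ v)).erase v,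
        ((if a w < a v then (1 : ℤ) else 0) - (if b w < a v then 1 else 0)) := by
    unfold signedCount
    rw [← Finset.sum_sub_distrib]
    refine Finset.sum_congr rfl fun w hw => ?_
    simp only [Finset.mem_erase] at hw
    have ha : a w ≠ a v := fun e => hw.1 (h.injective_source e)
    have hb : b w ≠ a v := fun e => hw.2.1 (h.injective_target (by rw [e, hσ]))
    rcases h.sign_cases w with ⟨hs, hw'⟩ | ⟨hs, hw'⟩ | ⟨hs, hw'⟩ <;> rw [hs] <;>
      split_ifs <;> omega
  rw [rest]
  have := hσ v
  simp only [this, lt_irrefl, if_false] at key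
  omega

theorem edgeLevel_apply [DecidableEq V] {O : Finset V} {σ : Equiv.Perm V}
    (hσ : ∀ v, b (σ v) = a v) (hO : ∀ v, v ∈ O ↔ σ v ∈ O) {v : V} (hv : v ∈ O) :
    edgeLevel a b s O (σ v) = edgeLevel a b s O v := by
  by_cases hne : σ v = v
  · rw [hne]
  have flow := h.signedCount_sub_signedCount hσ hO hv hne
  have hu := (hO v).1 hv
  have hp := hσ v
  set u := σ v
  have hab : b v ≠ a v := fun e => hne (h.injective_target (by rw [hp, e]))
  have hau : a u ≠ a v := fun e => hne (h.injective_source e)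
  have hrest : ∀ w ∈ (O.erase u).erase v, a w ≠ a v ∧ b w ≠ a v := fun w hw => by
    simp only [Finset.mem_erase] at hw
    exact ⟨fun e => hw.1 (h.injective_source e),
      fun e => hw.2.1 (h.injective_target (by rw [e, hp]))⟩
  set rest := (O.erase u).erase v
  set L := signedCount rest s (fun w => min (a w) (b w) < a v) with hL
  set R := signedCount rest s (fun w => max (a w) (b w) < a v) with hR
  have congr_rest : ∀ (P Q : V → Prop) [DecidablePred P] [DecidablePred Q],
      (∀ w, s w ≠ 0 → a w ≠ a v → b w ≠ a v → (P w ↔ Q w)) →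
      signedCount rest s P = signedCount rest s Q := fun P Q _ _ hPQ =>
    signedCount_congr fun w hw hs => hPQ w hs (hrest w hw).1 (hrest w hw).2
  have nest : ∀ x w, s x ≠ 0 → s w ≠ 0 →
      (min (a x) (b x) < min (a w) (b w) → max (a x) (b x) ≤ max (a w) (b w)) ∧
      (min (a w) (b w) < min (a x) (b x) → max (a w) (b w) ≤ max (a x) (b x)) :=
    fun x w hx hw => ⟨h.not_nested x w hx hw, h.not_nested w x hw hx⟩
  have level_v : edgeLevel a b s O v =
      if s v = 1 then L + (if a u + b u < a v + b v then s u else 0)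
      else if s v = -1 then R + s v + (if a u + b u ≤ a v + b v then s u else 0)
      else if a v < b v then L + s u
      else R := by
    unfold edgeLevel
    simp only [signedCount_eq_add_of_ne (s := s) hu hv hne]
    rcases h.sign_cases v with ⟨hs, hv'⟩ | ⟨hs, hv'⟩ | ⟨hs, hv'⟩
    · have h1 : s v ≠ 1 := by omega
      have h2 : s v ≠ -1 := by omega
      simp only [if_neg h1, if_neg h2]
      split_ifs <;> first
        | omega
        | rw [hL, congr_rest _ (fun w => min (a w) (b w) < a v) fun w _ _ _ => by omega]
          omega
        | rw [← hR]
          omega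
    · simp only [if_pos hs]
      rw [hL, congr_rest _ (fun w => min (a w) (b w) < a v) fun w hw _ _ => by
        have := nest v w (by omega) hw
        omega, if_neg (lt_irrefl (a v + b v)), add_zero]
    · have h1 : s v ≠ 1 := by omega
      simp only [if_pos hs, if_neg h1]
      rw [hR, congr_rest _ (fun w => max (a w) (b w) < a v) fun w hw _ _ => by
        have := nest v w (by omega) hw
        omega, if_pos (le_refl (a v + b v))]
  have level_u : edgeLevel a b s O u =
      if s u = 1 then R + (if a v + b v < a u + b u then s v else 0)
      else if s u = -1 then L + s u + (if a v + b v ≤ a u + b u then s v else 0)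
      else if a u < b u then L + (if b v < a v then s v else 0)
      else R + (if b v < a v then s v else 0) := by
    unfold edgeLevel
    simp only [signedCount_eq_add_of_ne (s := s) hu hv hne]
    rcases h.sign_cases u with ⟨hs, hu'⟩ | ⟨hs, hu'⟩ | ⟨hs, hu'⟩
    · have h1 : s u ≠ 1 := by omega
      have h2 : s u ≠ -1 := by omega
      simp only [if_neg h1, if_neg h2]
      have hv' := h.sign_cases v
      split_ifs <;> first
        | omega
        | rw [hL, congr_rest _ (fun w => min (a w) (b w) < a v) fun w _ _ _ => by omega]
          omega
        | rw [hR, congr_rest _ (fun w => max (a w) (b w) < a v) fun w _ _ _ => by omega]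
          omega
    · simp only [if_pos hs]
      rw [hR, congr_rest _ (fun w => max (a w) (b w) < a v) fun w hw _ _ => by
        have := nest u w (by omega) hw
        omega, if_neg (lt_irrefl (a u + b u)), add_zero]
    · have h1 : s u ≠ 1 := by omega
      simp only [if_pos hs, if_neg h1]
      rw [hL, congr_rest _ (fun w => min (a w) (b w) < a v) fun w hw _ _ => by
        have := nest u w (by omega) hw
        omega, if_pos (le_refl (a u + b u))]
      omega
  have huv := nest u v
  rw [level_u, level_v]
  clear_value L R u
  clear level_u level_v congr_rest nest hrest hL hR
  rcases h.sign_cases v with ⟨hs, hv'⟩ | ⟨hs, hv'⟩ | ⟨hs, hv'⟩ <;>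
    rcases h.sign_cases u with ⟨hs', hu'⟩ | ⟨hs', hu'⟩ | ⟨hs', hu'⟩ <;>
    rw [hs, hs'] at huv ⊢ <;> norm_num at huv ⊢ <;> split_ifs at flow ⊢ <;> omega

theorem signedCount_mem_edgeLevel {O : Finset V} {v : V} (hv : v ∈ O) (hs : s v ≠ 0) :
    (signedCount O s (fun w => a w + b w < a v + b v) = edgeLevel a b s O v ∨
      signedCount O s (fun w => a w + b w < a v + b v) = edgeLevel a b s O v + 1) ∧
    (signedCount O s (fun w => a w + b w ≤ a v + b v) = edgeLevel a b s O v ∨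
      signedCount O s (fun w => a w + b w ≤ a v + b v) = edgeLevel a b s O v + 1) := by
  set tied : ℤ → Finset V := fun e => O.filter fun w => a w + b w = a v + b v ∧ s w = e
  have ends : ∀ w, s w ≠ 0 → a w + b w = a v + b v →
      min (a w) (b w) = min (a v) (b v) ∧ max (a w) (b w) = max (a v) (b v) := by
    intro w hw hk
    have h1 := h.not_nested v w hs hw
    have h2 := h.not_nested w v hw hs
    omega
  have tied_le : ∀ e, e = 1 ∨ e = -1 → (tied e).card ≤ 1 := by
    intro e he
    refine Finset.card_le_one.2 fun x hx y hy => h.injective_source ?_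
    simp only [tied, Finset.mem_filter] at hx hy
    have hx' := ends x (by omega) hx.2.1
    have hy' := ends y (by omega) hy.2.1
    have := h.right x
    have := h.right y
    have := h.left x
    have := h.left y
    omega
  have mem_tied : 1 ≤ (tied (s v)).card := Finset.card_pos.2 ⟨v, by simp [tied, hv]⟩
  have diff : signedCount O s (fun w => a w + b w ≤ a v + b v) -
      signedCount O s (fun w => a w + b w < a v + b v) = (tied 1).card - (tied (-1)).card := by
    simp only [tied, signedCount, Finset.card_filter, Nat.cast_sum, ← Finset.sum_sub_distrib]
    refine Finset.sum_congr rfl fun w _ => ?_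
    rcases h.sign w with e | e | e <;> simp only [e] <;> split_ifs <;> grind
  have t1 := tied_le 1 (by simp)
  have t2 := tied_le (-1) (by simp)
  unfold edgeLevel
  rcases h.sign v with e | e | e
  · exact absurd e hs
  · rw [e] at mem_tied
    rw [if_pos e]
    omega
  · rw [e] at mem_tied
    rw [if_neg (by omega), if_pos e]
    omega

theorem abs_sum_le_one [DecidableEq V] {O : Finset V} {σ : Equiv.Perm V}
    (hσ : ∀ v, b (σ v) = a v) (hO : ∀ v, v ∈ O ↔ σ v ∈ O)
    (hcycle : ∀ v ∈ O, ∀ w ∈ O, σ.SameCycle v w) : |∑ w ∈ O, s w| ≤ 1 := by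
  have pow_level : ∀ v ∈ O, ∀ i : ℕ, (σ ^ i) v ∈ O ∧
      edgeLevel a b s O ((σ ^ i) v) = edgeLevel a b s O v := by
    intro v hv i
    induction i with
    | zero => exact ⟨hv, rfl⟩
    | succ i ih =>
      rw [pow_succ', Equiv.Perm.mul_apply]
      exact ⟨(hO _).1 ih.1, (h.edgeLevel_apply hσ hO ih.1).trans ih.2⟩
  have level : ∀ v ∈ O, ∀ w ∈ O, edgeLevel a b s O v = edgeLevel a b s O w := by
    intro v hv w hw
    obtain ⟨i, hi⟩ := hcycle v hv w hw
    obtain ⟨k, rfl | rfl⟩ := i.eq_nat_or_neg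
    · rw [zpow_natCast] at hi
      rw [← hi, (pow_level v hv k).2]
    · rw [zpow_neg, zpow_natCast, Equiv.Perm.inv_eq_iff_eq] at hi
      rw [hi, (pow_level w hw k).2]
  rcases (O.filter fun w => s w ≠ 0).eq_empty_or_nonempty with he | hne
  · rw [Finset.sum_eq_zero fun w hw => ?_]
    · simp
    · by_contra hs
      exact Finset.notMem_empty w (he ▸ Finset.mem_filter.2 ⟨hw, hs⟩)
  obtain ⟨x, hx, hmin⟩ := Finset.exists_min_image _ (fun w => a w + b w) hne
  obtain ⟨y, hy, hmax⟩ := Finset.exists_max_image _ (fun w => a w + b w) hne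
  simp only [Finset.mem_filter, and_imp] at hx hy hmin hmax
  have first : signedCount O s (fun w => a w + b w < a x + b x) = 0 :=
    (signedCount_congr (Q := fun _ => False) fun w hw hs => by
      simpa using hmin w hw hs).trans (by simp [signedCount])
  have last : signedCount O s (fun w => a w + b w ≤ a y + b y) = ∑ w ∈ O, s w :=
    (signedCount_congr (Q := fun _ => True) fun w hw hs => by
      simpa using hmax w hw hs).trans (by simp [signedCount])
  have hx' := (h.signedCount_mem_edgeLevel hx.1 hx.2).1
  have hy' := (h.signedCount_mem_edgeLevel hy.1 hy.2).2
  have := level x hx.1 y hy.1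
  rw [abs_le]
  omega

end SignedEdges

end CycleLemma

/-- the combinatorial cycle lemma. -/
theorem stmt11 (nb : ℕ) (MA MB : Equiv.Perm (Fin nb)) (Ab Bb : Finset (Fin nb))
    (ha : ∀ v, v ∉ symmDiff Ab Bb → |((MA v : ℤ)) - ((MB v : ℤ))| ≤ 1)
    (hb : ∀ v ∈ Ab \ Bb, MA v ≤ MB v)
    (hb' : ∀ v ∈ Bb \ Ab, MB v ≤ MA v)
    (hc : ¬ ∃ v₁ ∈ symmDiff Ab Bb, ∃ v₂ ∈ symmDiff Ab Bb,
      min (MA v₁) (MB v₁) < min (MA v₂) (MB v₂) ∧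
      max (MA v₂) (MB v₂) < max (MA v₁) (MB v₁))
    (σ : Equiv.Perm (Fin nb)) (hσ : σ = MA.trans MB.symm)
    (O : Set (Fin nb)) (v₀ : Fin nb) (hO : O = {v | σ.SameCycle v₀ v}) :
    |(((Ab : Set (Fin nb)) ∩ O).ncard : ℤ) -
      (((Bb : Set (Fin nb)) ∩ O).ncard : ℤ)| ≤ 1 := by
  classical
  set S : Finset (Fin nb) := Finset.univ.filter (σ.SameCycle v₀)
  have hOS : O = (S : Set (Fin nb)) := by simp [hO, S]
  set s : Fin nb → ℤ := fun v => (if v ∈ Ab then 1 else 0) - (if v ∈ Bb then 1 else 0) with hs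
  have mem_symmDiff_of_ne : ∀ v, s v ≠ 0 → v ∈ symmDiff Ab Bb := fun v hv => by
    simp only [hs] at hv
    rw [Finset.mem_symmDiff]
    split_ifs at hv <;> simp_all
  have h : SignedEdges (fun v => ((MA v : ℕ) : ℤ)) (fun v => ((MB v : ℕ) : ℤ)) s := by
    refine ⟨fun v => ?_, fun v w e => ?_, fun v w e => ?_, fun v hv => ?_, fun v hv => ?_,
      fun v hv => ?_, fun v w hv hw hlt => ?_⟩
    · simp only [hs]
      split_ifs <;> simp
    · exact MA.injective (Fin.ext (by simpa using e))
    · exact MB.injective (Fin.ext (by simpa using e))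
    · refine ha v fun hm => ?_
      rw [Finset.mem_symmDiff] at hm
      rcases hm with hm | hm <;> simp [hs, hm.1, hm.2] at hv
    · have hm : v ∈ Ab \ Bb := by
        simp only [hs] at hv
        rw [Finset.mem_sdiff]
        split_ifs at hv <;> simp_all
      exact_mod_cast hb v hm
    · have hm : v ∈ Bb \ Ab := by
        simp only [hs] at hv
        rw [Finset.mem_sdiff]
        split_ifs at hv <;> simp_all
      exact_mod_cast hb' v hm
    · by_contra hlt'
      refine hc ⟨v, mem_symmDiff_of_ne v hv, w, mem_symmDiff_of_ne w hw, ?_, ?_⟩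
      · simp only [Fin.lt_def, Fin.coe_min]
        omega
      · simp only [Fin.lt_def, Fin.coe_max]
        omega
  have card_sub : (((Ab : Set (Fin nb)) ∩ O).ncard : ℤ) -
      (((Bb : Set (Fin nb)) ∩ O).ncard : ℤ) = ∑ w ∈ S, s w := by
    rw [hOS, ← Finset.coe_inter, ← Finset.coe_inter, Set.ncard_coe_finset, Set.ncard_coe_finset,
      Finset.inter_comm Ab, Finset.inter_comm Bb, Finset.sum_sub_distrib]
    simp
  rw [card_sub]
  refine h.abs_sum_le_one (σ := σ) (fun v => by simp [hσ]) (fun v => ?_) fun v hv w hw => ?_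
  · simp [S]
  · simp only [S, Finset.mem_filter, Finset.mem_univ, true_and] at hv hw
    exact hv.symm.trans hw
end

section
/- The set function cost is supermodular: for every set A ⊆ Fin n and all distinct s, t ∈ Fin n with s ∉ A and t ∉ A, one has cost(A) + cost(A ∪ {s, t}) ≥ cost(A ∪ {s}) + cost(A ∪ {t}). -/
open Finset

/-- Abel's inequality: nonnegative partial sums against an antitone weight. -/
theorem mul_sum_le_sum_mul_of_antitone {n : ℕ} (x D : Fin n → ℝ) (hD : Antitone D)
    (hx : ∀ k : ℕ, 0 ≤ ∑ j with (j : Fin n).val < k, x j) (z : ℝ) (hz : ∀ j, z ≤ D j) :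
    z * ∑ j, x j ≤ ∑ j, x j * D j := by
  induction n generalizing z with
  | zero => simp
  | succ n ih =>
    have hpart : ∀ k : ℕ, 0 ≤ ∑ j with (j : Fin n).val < k, x j.castSucc := by
      intro k
      have h := hx (min k n)
      rw [Finset.sum_filter, Fin.sum_univ_castSucc] at h
      simpa [Finset.sum_filter] using h
    have hrec := ih (fun j => x j.castSucc) (fun j => D j.castSucc)
      (fun i j hij => hD (Fin.castSucc_le_castSucc_iff.2 hij)) hpart (D (Fin.last n))
      (fun j => hD (Fin.le_last _))
    have hfull : 0 ≤ ∑ j, x j := by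
      have h := hx (n + 1)
      rwa [Finset.filter_true_of_mem (fun j _ => j.isLt)] at h
    have hlast := mul_le_mul_of_nonneg_right (hz (Fin.last n)) hfull
    rw [Fin.sum_univ_castSucc] at hlast ⊢
    rw [Fin.sum_univ_castSucc (fun j => x j * D j)]
    linarith

/-- A set of smallest elements has the smallest sum among sets of its cardinality. -/
theorem sum_le_sum_of_card_eq_of_forall_le {ι : Type*} [DecidableEq ι] (w : ι → ℝ)
    (P T : Finset ι) (hcard : P.card = T.card) (h : ∀ x ∈ P, ∀ y ∉ P, w x ≤ w y) :
    ∑ i ∈ P, w i ≤ ∑ i ∈ T, w i := by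
  have hc : (P \ T).card = (T \ P).card := Finset.card_sdiff_comm hcard
  rw [← Finset.sum_sdiff_le_sum_sdiff]
  let e := Finset.equivOfCardEq hc
  rw [← Finset.sum_coe_sort (P \ T), ← Finset.sum_coe_sort (T \ P), ← e.sum_comp]
  exact Finset.sum_le_sum fun i _ =>
    h _ (Finset.mem_sdiff.1 i.2).1 _ (Finset.mem_sdiff.1 (e i).2).2

theorem sum_image_perm_lt {n : ℕ} (w : Fin n → ℝ) (ρ : Equiv.Perm (Fin n)) (k : ℕ) :
    ∑ i ∈ (univ.filter fun j : Fin n => j.val < k).image ρ, w i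
      = ∑ j with (j : Fin n).val < k, w (ρ j) :=
  Finset.sum_image ρ.injective.injOn

/-- The first `k` values along a sorting permutation have the smallest sum among `k`-sets. -/
theorem sum_lt_le_sum_of_monotone {n : ℕ} (w : Fin n → ℝ) (ρ : Equiv.Perm (Fin n))
    (hρ : Monotone (w ∘ ρ)) (k : ℕ) (T : Finset (Fin n))
    (hT : T.card = (univ.filter fun j : Fin n => j.val < k).card) :
    ∑ j with (j : Fin n).val < k, w (ρ j) ≤ ∑ i ∈ T, w i := by
  rw [← sum_image_perm_lt]
  refine sum_le_sum_of_card_eq_of_forall_le w _ T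
    ((Finset.card_image_of_injective _ ρ.injective).trans hT.symm) ?_
  intro x hx y hy
  obtain ⟨i, hi, rfl⟩ := Finset.mem_image.1 hx
  obtain ⟨j, rfl⟩ := ρ.surjective y
  have hj : ¬ j.val < k := fun hlt =>
    hy (Finset.mem_image_of_mem ρ (Finset.mem_filter.2 ⟨Finset.mem_univ _, hlt⟩))
  have hi' : i.val < k := (Finset.mem_filter.1 hi).2
  exact hρ (Fin.le_def.2 (by omega))

/-- Upgrading `s` lowers the total cost of a supplier set containing `s` by `c s - b s`. -/
theorem sum_effective_union_singleton {ι : Type*} [DecidableEq ι] (b c : ι → ℝ)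
    (A T : Finset ι) (s : ι) (hs : s ∉ A) :
    ∑ i ∈ T, (if i ∈ A ∪ {s} then b i else c i)
      = ∑ i ∈ T, (if i ∈ A then b i else c i) - if s ∈ T then c s - b s else 0 := by
  rw [← Finset.sum_ite_eq' T s (fun i => c i - b i), ← Finset.sum_sub_distrib]
  refine Finset.sum_congr rfl fun i _ => ?_
  by_cases h : i = s
  · subst h; simp [hs]
  · simp [h]

/-- Exchange property behind supermodularity of the minimum sum over sets of fixed cardinality. -/
theorem exists_exchange {ι : Type*} [DecidableEq ι] (b c : ι → ℝ) (hbc : ∀ i, b i ≤ c i)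
    (A : Finset ι) (s t : ι) (hst : s ≠ t) (hs : s ∉ A) (ht : t ∉ A)
    (T₁ T₂ : Finset ι) (hcard : T₁.card = T₂.card) :
    ∃ U₁ U₂ : Finset ι, U₁.card = T₁.card ∧ U₂.card = T₁.card ∧
      ∑ i ∈ U₁, (if i ∈ A ∪ {s} then b i else c i)
          + ∑ i ∈ U₂, (if i ∈ A ∪ {t} then b i else c i)
        ≤ ∑ i ∈ T₁, (if i ∈ A then b i else c i)
          + ∑ i ∈ T₂, (if i ∈ A ∪ {s, t} then b i else c i) := by
  have hpair : A ∪ {s, t} = (A ∪ {s}) ∪ {t} := by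
    ext i; simp only [Finset.mem_union, Finset.mem_insert, Finset.mem_singleton]; tauto
  have ht' : t ∉ A ∪ {s} := by simp [ht, hst.symm]
  simp only [hpair, sum_effective_union_singleton b c (A ∪ {s}) _ t ht',
    sum_effective_union_singleton b c A _ s hs, sum_effective_union_singleton b c A _ t ht]
  have hbs := hbc s
  have hbt := hbc t
  by_cases h₁ : s ∈ T₁ ∨ s ∉ T₂
  · refine ⟨T₁, T₂, rfl, hcard.symm, ?_⟩
    split_ifs <;> first | linarith | tauto
  by_cases h₂ : t ∈ T₁ ∨ t ∉ T₂
  · refine ⟨T₂, T₁, hcard.symm, rfl, ?_⟩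
    split_ifs <;> first | linarith | tauto
  push Not at h₁ h₂
  obtain ⟨hs₁, hs₂⟩ := h₁
  obtain ⟨ht₁, ht₂⟩ := h₂
  obtain ⟨x, hx⟩ : (T₁ \ T₂).Nonempty := by
    rw [← Finset.card_pos, Finset.card_sdiff_comm hcard, Finset.card_pos]
    exact ⟨s, Finset.mem_sdiff.2 ⟨hs₂, hs₁⟩⟩
  obtain ⟨hx₁, hx₂⟩ := Finset.mem_sdiff.1 hx
  have hsx : s ∉ T₁.erase x := fun h => hs₁ (Finset.mem_of_mem_erase h)
  have hxs : x ∉ T₂.erase s := fun h => hx₂ (Finset.mem_of_mem_erase h)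
  refine ⟨insert s (T₁.erase x), insert x (T₂.erase s), ?_, ?_, ?_⟩
  · rw [Finset.card_insert_of_notMem hsx, Finset.card_erase_add_one hx₁]
  · rw [Finset.card_insert_of_notMem hxs, Finset.card_erase_add_one hs₂, hcard]
  · have e₁ := Finset.add_sum_erase T₁ (fun i => if i ∈ A then b i else c i) hx₁
    have e₂ := Finset.add_sum_erase T₂ (fun i => if i ∈ A then b i else c i) hs₂
    have htmem : t ∈ insert x (T₂.erase s) :=
      Finset.mem_insert_of_mem (Finset.mem_erase.2 ⟨hst.symm, ht₂⟩)
    rw [Finset.sum_insert hsx, Finset.sum_insert hxs, if_pos (Finset.mem_insert_self _ _),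
      if_pos htmem, if_pos hs₂, if_pos ht₂]
    linarith

/-- Reindexing the customers by a permutation. -/
theorem assignCost_eq_sum_comp {n : ℕ} (b c d : Fin n → ℝ) (A : Finset (Fin n))
    (π e : Equiv.Perm (Fin n)) :
    assignCost b c d A π
      = ∑ j, (if π (e j) ∈ A then b (π (e j)) else c (π (e j))) * d (e j) :=
  (Equiv.sum_comp e fun j => (if π j ∈ A then b (π j) else c (π j)) * d j).symm

/-- the set function `cost` is supermodular. -/
theorem stmt12 (n : ℕ) (hn : 1 ≤ n) (b c d : Fin n → ℝ)
    (hb : ∀ i, 0 ≤ b i) (hbc : ∀ i, b i ≤ c i) (hd : ∀ j, 0 ≤ d j)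
    (A : Finset (Fin n)) (s t : Fin n) (hst : s ≠ t)
    (hs : s ∉ A) (ht : t ∉ A) :
    cost b c d (A ∪ {s}) + cost b c d (A ∪ {t}) ≤
      cost b c d A + cost b c d (A ∪ {s, t}) := by
  obtain ⟨π, -, hπ⟩ := Finset.exists_mem_eq_inf' Finset.univ_nonempty (assignCost b c d A)
  obtain ⟨σ, -, hσ⟩ :=
    Finset.exists_mem_eq_inf' Finset.univ_nonempty (assignCost b c d (A ∪ {s, t}))
  let e : Equiv.Perm (Fin n) := Tuple.sort (fun j => -d j)
  have he : Antitone (d ∘ e) := fun i j hij =>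
    neg_le_neg_iff.1 (Tuple.monotone_sort (fun j => -d j) hij)
  let w : Finset (Fin n) → Fin n → ℝ := fun B i => if i ∈ B then b i else c i
  let ρ : Finset (Fin n) → Equiv.Perm (Fin n) := fun B => Tuple.sort (w B)
  have hcost : ∀ B, cost b c d B ≤ ∑ j, w B (ρ B j) * d (e j) := by
    intro B
    refine (Finset.inf'_le _ (Finset.mem_univ (e.symm.trans (ρ B)))).trans_eq ?_
    rw [assignCost_eq_sum_comp b c d B _ e]
    simp [w]
  have hA : cost b c d A = ∑ j, w A (π (e j)) * d (e j) :=
    hπ.trans (assignCost_eq_sum_comp b c d A π e)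
  have hAst : cost b c d (A ∪ {s, t}) = ∑ j, w (A ∪ {s, t}) (σ (e j)) * d (e j) :=
    hσ.trans (assignCost_eq_sum_comp b c d _ σ e)
  have habel := mul_sum_le_sum_mul_of_antitone
    (fun j => w A (π (e j)) + w (A ∪ {s, t}) (σ (e j))
      - w (A ∪ {s}) (ρ (A ∪ {s}) j) - w (A ∪ {t}) (ρ (A ∪ {t}) j))
    (d ∘ e) he ?_ 0 (fun j => hd (e j))
  · simp only [zero_mul, Function.comp_apply, sub_mul, add_mul, Finset.sum_sub_distrib,
      Finset.sum_add_distrib] at habel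
    linarith [hcost (A ∪ {s}), hcost (A ∪ {t})]
  · intro k
    have hc : ∀ τ : Equiv.Perm (Fin n),
        ((univ.filter fun j : Fin n => j.val < k).image τ).card
          = (univ.filter fun j : Fin n => j.val < k).card :=
      fun τ => Finset.card_image_of_injective _ τ.injective
    obtain ⟨U₁, U₂, hU₁, hU₂, hU⟩ := exists_exchange b c hbc A s t hst hs ht
      ((univ.filter fun j : Fin n => j.val < k).image (e.trans π))
      ((univ.filter fun j : Fin n => j.val < k).image (e.trans σ))
      ((hc _).trans (hc _).symm)
    have h₁ := sum_lt_le_sum_of_monotone (w (A ∪ {s})) (ρ (A ∪ {s}))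
      (Tuple.monotone_sort _) k U₁ (hU₁.trans (hc _))
    have h₂ := sum_lt_le_sum_of_monotone (w (A ∪ {t})) (ρ (A ∪ {t}))
      (Tuple.monotone_sort _) k U₂ (hU₂.trans (hc _))
    have h₃ := sum_image_perm_lt (w A) (e.trans π) k
    have h₄ := sum_image_perm_lt (w (A ∪ {s, t})) (e.trans σ) k
    simp only [Equiv.trans_apply] at h₃ h₄
    simp only [Finset.sum_sub_distrib, Finset.sum_add_distrib]
    linarith
end

section
/- Let b, c, c', d : Fin n → ℝ satisfy 0 ≤ b i and b i ≤ c i ≤ c' i for every i, with both c and c' monotone nondecreasing and d j ≥ 0 for every j. Let s ∈ Fin n with c s = c' s. Write cost_c(A) for the cost of the instance with regular costs c and upgraded costs b, and cost_{c'}(A) for the cost of the instance with regular costs c' and upgraded costs b. Then cost_c(∅) − cost_c({s}) ≤ cost_{c'}(∅) − cost_{c'}({s}). -/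
open Finset

/-- Abel summation: nonnegative prefix sums pair nonnegatively with a nonnegative
antitone weight. -/
theorem sum_mul_nonneg_of_prefix_sum_nonneg {n : ℕ} (h e : Fin n → ℝ) (he : Antitone e)
    (he0 : ∀ j, 0 ≤ e j) (hh : ∀ k, 0 ≤ ∑ j, if j ≤ k then h j else 0) :
    0 ≤ ∑ j, h j * e j := by
  induction n with
  | zero => simp
  | succ n ih =>
    have hinit := ih (fun j => h j.castSucc) (fun j => e j.castSucc - e (Fin.last n))
      (fun i j hij => sub_le_sub_right (he (Fin.castSucc_le_castSucc_iff.2 hij)) _)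
      (fun j => sub_nonneg.2 (he (Fin.le_last _)))
      (fun k => by
        have hk := hh k.castSucc
        rw [Fin.sum_univ_castSucc, if_neg (not_le.2 (Fin.castSucc_lt_last k))] at hk
        simpa using hk)
    have hlast := hh (Fin.last n)
    simp only [Fin.le_last, if_true] at hlast
    have hmul := mul_nonneg hlast (he0 (Fin.last n))
    rw [Fin.sum_univ_castSucc] at hmul ⊢
    simp only [mul_sub, Finset.sum_sub_distrib, ← Finset.sum_mul] at hinit
    linarith

/-- A prefix sum of a monotone sequence is minimal among sums over sets of the same size. -/
theorem Monotone.sum_Iic_le_sum_of_card_eq {n : ℕ} {f : Fin n → ℝ} (hf : Monotone f)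
    (k : Fin n) (T : Finset (Fin n)) (hT : T.card = (Finset.Iic k).card) :
    ∑ j ∈ Finset.Iic k, f j ≤ ∑ j ∈ T, f j := by
  rw [← Finset.sum_sdiff_le_sum_sdiff]
  calc ∑ j ∈ Finset.Iic k \ T, f j ≤ (Finset.Iic k \ T).card • f k :=
        Finset.sum_le_card_nsmul _ _ _ fun j hj => hf (by simp at hj; exact hj.1)
    _ = (T \ Finset.Iic k).card • f k := by rw [Finset.card_sdiff_comm hT]
    _ ≤ ∑ j ∈ T \ Finset.Iic k, f j :=
        Finset.card_nsmul_le_sum _ _ _ fun j hj => hf (by simp at hj; exact hj.2.le)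

/-- Exchange argument for lowering the coordinate `s` in two comparable vectors. -/
theorem exists_exchange_s13 {n : ℕ} {c c' u u' : Fin n → ℝ} {s : Fin n}
    (hcc' : ∀ i, c i ≤ c' i) (hs : c s = c' s) (hus : u s = u' s) (huc : u s ≤ c s)
    (hu : ∀ i, i ≠ s → u i = c i) (hu' : ∀ i, i ≠ s → u' i = c' i)
    (K L : Finset (Fin n)) (hKL : K.card = L.card) :
    ∃ K' L' : Finset (Fin n), K'.card = K.card ∧ L'.card = K.card ∧
      ∑ i ∈ K', c i + ∑ i ∈ L', u' i ≤ ∑ i ∈ K, c' i + ∑ i ∈ L, u i := by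
  by_cases hL : s ∈ L
  · by_cases hK : s ∈ K
    · refine ⟨L, K, hKL.symm, rfl, ?_⟩
      rw [← Finset.add_sum_erase _ c hL, ← Finset.add_sum_erase _ u hL,
        ← Finset.add_sum_erase _ c' hK, ← Finset.add_sum_erase _ u' hK,
        Finset.sum_congr rfl fun i hi => hu i (Finset.ne_of_mem_erase hi),
        Finset.sum_congr rfl fun i hi => hu' i (Finset.ne_of_mem_erase hi)]
      linarith
    · obtain ⟨i, hiK, hiL⟩ : ∃ i ∈ K, i ∉ L := by
        by_contra! hsub
        exact hK (Finset.eq_of_subset_of_card_le hsub hKL.ge ▸ hL)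
      have hsK : s ∉ K.erase i := fun h => hK (Finset.mem_of_mem_erase h)
      have hiL' : i ∉ L.erase s := fun h => hiL (Finset.mem_of_mem_erase h)
      refine ⟨insert i (L.erase s), insert s (K.erase i), ?_, ?_, ?_⟩
      · rw [Finset.card_insert_of_notMem hiL', Finset.card_erase_add_one hL, hKL]
      · rw [Finset.card_insert_of_notMem hsK, Finset.card_erase_add_one hiK]
      · rw [Finset.sum_insert hiL', Finset.sum_insert hsK, ← Finset.add_sum_erase _ u hL,
          ← Finset.add_sum_erase _ c' hiK,
          Finset.sum_congr rfl fun i hi => hu i (Finset.ne_of_mem_erase hi),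
          Finset.sum_congr rfl fun j hj => hu' j fun h => hsK (h ▸ hj)]
        linarith [hcc' i]
  · refine ⟨L, K, hKL.symm, rfl, ?_⟩
    rw [Finset.sum_congr rfl fun i hi => hu i fun h => hL (h ▸ hi), add_comm]
    refine add_le_add_left (Finset.sum_le_sum fun i _ => ?_) _
    rcases eq_or_ne i s with rfl | hi
    · rw [← hus, ← hs]
      exact huc
    · exact (hu' i hi).le

theorem cost_le_sum {n : ℕ} (b c d : Fin n → ℝ) (A : Finset (Fin n))
    (τ ρ : Equiv.Perm (Fin n)) :
    cost b c d A ≤ ∑ j, (if ρ j ∈ A then b (ρ j) else c (ρ j)) * d (τ j) := by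
  refine (Finset.inf'_le _ (Finset.mem_univ (τ.symm.trans ρ))).trans_eq ?_
  rw [assignCost, ← Equiv.sum_comp τ]
  simp

theorem exists_cost_eq_sum {n : ℕ} (b c d : Fin n → ℝ) (A : Finset (Fin n))
    (τ : Equiv.Perm (Fin n)) :
    ∃ ρ : Equiv.Perm (Fin n),
      cost b c d A = ∑ j, (if ρ j ∈ A then b (ρ j) else c (ρ j)) * d (τ j) := by
  obtain ⟨π, -, hπ⟩ := Finset.exists_mem_eq_inf' Finset.univ_nonempty (assignCost b c d A)
  refine ⟨τ.trans π, ?_⟩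
  rw [cost, hπ, assignCost, ← Equiv.sum_comp τ]
  rfl

/-- monotone comparison of the gain of one upgrade between two
instances with pointwise larger regular costs. -/
theorem stmt13 (n : ℕ) (hn : 1 ≤ n) (b c c' d : Fin n → ℝ)
    (hb : ∀ i, 0 ≤ b i) (hbc : ∀ i, b i ≤ c i) (hcc' : ∀ i, c i ≤ c' i)
    (hcmono : Monotone c) (hc'mono : Monotone c')
    (hd : ∀ j, 0 ≤ d j) (s : Fin n) (hs : c s = c' s) :
    cost b c d ∅ - cost b c d {s} ≤ cost b c' d ∅ - cost b c' d {s} := by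
  let τ : Equiv.Perm (Fin n) := Tuple.sort fun j => -d j
  have hτ : Antitone (d ∘ τ) := fun i j hij => by
    simpa using Tuple.monotone_sort (fun j => -d j) hij
  obtain ⟨π, hπ⟩ := exists_cost_eq_sum b c' d ∅ τ
  obtain ⟨σ, hσ⟩ := exists_cost_eq_sum b c d {s} τ
  let u : Fin n → ℝ := fun i => if i ∈ ({s} : Finset (Fin n)) then b i else c i
  let u' : Fin n → ℝ := fun i => if i ∈ ({s} : Finset (Fin n)) then b i else c' i
  let α : Equiv.Perm (Fin n) := Tuple.sort c
  let β : Equiv.Perm (Fin n) := Tuple.sort u'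
  have hα := cost_le_sum b c d ∅ τ α
  have hβ := cost_le_sum b c' d {s} τ β
  have hmin (x : Fin n → ℝ) (k : Fin n) (T : Finset (Fin n))
      (hT : T.card = (Finset.Iic k).card) :
      ∑ j ∈ Finset.Iic k, x (Tuple.sort x j) ≤ ∑ i ∈ T, x i := by
    have h := (Tuple.monotone_sort x).sum_Iic_le_sum_of_card_eq k
      (T.map (Tuple.sort x).symm.toEmbedding) (by simpa using hT)
    simpa using h
  have key := sum_mul_nonneg_of_prefix_sum_nonneg
    (fun j => (c' (π j) + u (σ j)) - (c (α j) + u' (β j))) (d ∘ τ) hτ (fun j => hd _)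
    (fun k => by
      obtain ⟨K', L', hK', hL', hle⟩ := exists_exchange_s13 (u := u) (u' := u') hcc' hs
        (by simp [u, u']) (by simpa [u] using hbc s) (fun i hi => by simp [u, hi])
        (fun i hi => by simp [u', hi]) ((Finset.Iic k).map π.toEmbedding)
        ((Finset.Iic k).map σ.toEmbedding) (by simp)
      rw [Finset.card_map] at hK' hL'
      have h1 := hmin c k K' hK'
      have h2 := hmin u' k L' hL'
      simp only [Finset.sum_map, Equiv.coe_toEmbedding] at hle
      rw [← Finset.sum_filter, show Finset.univ.filter (· ≤ k) = Finset.Iic k by ext; simp]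
      simp only [Finset.sum_sub_distrib, Finset.sum_add_distrib]
      linarith)
  simp only [sub_mul, add_mul, Finset.sum_sub_distrib, Finset.sum_add_distrib,
    Function.comp_apply] at key
  simp only [Finset.notMem_empty, if_false] at hα hπ
  linarith
end
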